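/- Let U be a finite type, f : Finset U → ℝ be nonnegative, monotone and submodular, T ≥ 1, and P^1, …, P^T, G^1, …, G^T ⊆ U be arbitrary sets. Then Σ_{t=1}^{T−1} [ f(⋃_{s=1}^{t} P^s | ⋃_{s=1}^{t} G^s) − f(⋃_{s=1}^{t} P^s | ⋃_{s=1}^{t+1} G^s) ] ≤ f(⋃_{t=1}^{T} P^t). -/

import Mathlib

/-- A set function is submodular if
`f (A ∪ {e}) - f A ≥ f (B ∪ {e}) - f B` for all `A ⊆ B` and `e ∉ B`. -/
def IsSubmodular {U : Type*} [DecidableEq U] (f : Finset U → ℝ) : Prop :=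
  ∀ A B : Finset U, A ⊆ B → ∀ e ∉ B, f (insert e A) - f A ≥ f (insert e B) - f B

/-- A set function is monotone if `f A ≤ f B` whenever `A ⊆ B`. -/
def IsMonotoneFn {U : Type*} [DecidableEq U] (f : Finset U → ℝ) : Prop :=
  ∀ A B : Finset U, A ⊆ B → f A ≤ f B

/-- The marginal gain `f(A | B) = f (A ∪ B) - f B`. -/
def marg {U : Type*} [DecidableEq U] (f : Finset U → ℝ) (A B : Finset U) : ℝ :=
  f (A ∪ B) - f B

/-- The union of the first `n` sets of the family `X` (empty for `n = 0`). -/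
def prefUnion {U : Type*} [DecidableEq U] {T : ℕ} (X : Fin T → Finset U) (n : ℕ) :
    Finset U :=
  (Finset.univ.filter (fun s : Fin T => (s : ℕ) < n)).biUnion X

/-- Marginal gains of a monotone submodular function are antitone in the conditioning set. -/
theorem IsSubmodular.marg_anti {U : Type*} [DecidableEq U] {f : Finset U → ℝ}
    (hsub : IsSubmodular f) (hmono : IsMonotoneFn f) {A B : Finset U} (hAB : A ⊆ B)
    (C : Finset U) : marg f C B ≤ marg f C A := by
  unfold marg
  induction C using Finset.induction_on with
  | empty => simp
  | insert e C _ ih =>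
    rw [Finset.insert_union, Finset.insert_union]
    by_cases hB : e ∈ C ∪ B
    · rw [Finset.insert_eq_of_mem hB]
      linarith [hmono _ _ (Finset.subset_insert e (C ∪ A))]
    · linarith [hsub _ _ (Finset.union_subset_union_right (s := C) hAB) e hB]

/-- Enlarging the conditioning set loses more marginal gain for a larger set. -/
theorem IsSubmodular.marg_sub_marg_le {U : Type*} [DecidableEq U] {f : Finset U → ℝ}
    (hsub : IsSubmodular f) (hmono : IsMonotoneFn f) {A B C D : Finset U} (hAB : A ⊆ B)
    (hCD : C ⊆ D) : marg f A C - marg f A D ≤ marg f B C - marg f B D := by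
  have union_absorb (X : Finset U) : D ∪ (X ∪ C) = X ∪ D := by
    rw [Finset.union_left_comm, Finset.union_eq_left.mpr hCD]
  have h := hsub.marg_anti hmono (Finset.union_subset_union_left (t := C) hAB) D
  simp only [marg, union_absorb] at h ⊢
  linarith

theorem prefUnion_mono {U : Type*} [DecidableEq U] {T : ℕ} (X : Fin T → Finset U) :
    Monotone (prefUnion X) := fun _ _ hmn =>
  Finset.biUnion_subset_biUnion_of_subset_left X
    (Finset.monotone_filter_right _ fun _ _ hs => lt_of_lt_of_le hs hmn)

theorem prefUnion_subset {U : Type*} [DecidableEq U] {T : ℕ} (X : Fin T → Finset U) (n : ℕ) :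
    prefUnion X n ⊆ Finset.univ.biUnion X :=
  Finset.biUnion_subset_biUnion_of_subset_left X (Finset.filter_subset _ _)

/-- For nonnegative, monotone and submodular `f` and arbitrary
families `P`, `G`,
`Σ_{t=1}^{T-1} [f(⋃_{s≤t} P^s | ⋃_{s≤t} G^s) - f(⋃_{s≤t} P^s | ⋃_{s≤t+1} G^s)] ≤ f(⋃_{t=1}^T P^t)`. -/
theorem telescoping_sum_bound {U : Type*} [Fintype U] [DecidableEq U]
    (f : Finset U → ℝ) (hnonneg : ∀ A : Finset U, 0 ≤ f A)
    (hmono : IsMonotoneFn f) (hsub : IsSubmodular f)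
    (T : ℕ) (hT : 1 ≤ T) (P G : Fin T → Finset U) :
    (∑ t ∈ Finset.range (T - 1),
        (marg f (prefUnion P (t + 1)) (prefUnion G (t + 1))
          - marg f (prefUnion P (t + 1)) (prefUnion G (t + 2))))
      ≤ f (Finset.univ.biUnion P) := by
  have hterm := Finset.sum_le_sum fun t (_ : t ∈ Finset.range (T - 1)) =>
    hsub.marg_sub_marg_le hmono (prefUnion_subset P (t + 1))
      (prefUnion_mono G (Nat.le_succ (t + 1)))
  refine hterm.trans ?_
  rw [Finset.sum_range_sub' fun t => marg f (Finset.univ.biUnion P) (prefUnion G (t + 1))]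
  have hfirst := hsub.marg_anti hmono (Finset.empty_subset (prefUnion G (0 + 1)))
    (Finset.univ.biUnion P)
  have hlast : 0 ≤ marg f (Finset.univ.biUnion P) (prefUnion G (T - 1 + 1)) :=
    sub_nonneg.mpr (hmono _ _ Finset.subset_union_right)
  have hempty : marg f (Finset.univ.biUnion P) ∅ ≤ f (Finset.univ.biUnion P) := by
    simpa [marg] using hnonneg ∅
  linarith
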